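/- arXiv:0907.1137 — 2 statements merged into one kernel-verified Lean document; each statement's English description precedes it below -/
import Mathlib

section
/- For all x, y in W, the set {uy : u ∈ W, u ≤ x} has a unique maximal element in Bruhat order, denoted x ∗ y, and x ∗ y is also the unique maximal element in Bruhat order of the set {xv : v ∈ W, v ≤ y}. Moreover, there exist x₁, y₁ ∈ W with x₁ ≤ x, y₁ ≤ y, x ∗ y = x₁ y = x y₁, and l(x ∗ y) = l(x₁) + l(y) = l(x) + l(y₁). -/
/-! Common setup: a finite Coxeter system, Bruhat order, and the sets
`{u * y : u ≤ x}` and `{x * v : v ≤ y}` used to characterize the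
Demazure product `∗` and the operations `▷`, `◁`. -/

/-- The Bruhat order on a Coxeter group: the reflexive-transitive closure of
the relation `u → u * t`, where `t` is a reflection and right multiplication
by `t` increases length. -/
def CoxeterSystem.bruhatLE {B W : Type*} [Group W] {M : CoxeterMatrix B}
    (cs : CoxeterSystem M W) : W → W → Prop :=
  Relation.ReflTransGen
    (fun u v => ∃ t, cs.IsReflection t ∧ v = u * t ∧ cs.length u < cs.length v)

/-- The set `{u * y : u ∈ W, u ≤ x}`. -/
def CoxeterSystem.lset {B W : Type*} [Group W] {M : CoxeterMatrix B}
    (cs : CoxeterSystem M W) (x y : W) : Set W :=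
  {z | ∃ u, cs.bruhatLE u x ∧ z = u * y}

/-- The set `{x * v : v ∈ W, v ≤ y}`. -/
def CoxeterSystem.rset {B W : Type*} [Group W] {M : CoxeterMatrix B}
    (cs : CoxeterSystem M W) (x y : W) : Set W :=
  {z | ∃ v, cs.bruhatLE v y ∧ z = x * v}

namespace CoxeterSystem

section

variable {B W : Type*} [Group W] {M : CoxeterMatrix B} (cs : CoxeterSystem M W)

open Classical in
/-- The action of a simple reflection on `W × ZMod 2`: conjugate the first coordinate, and flip
the second one when the first is the simple reflection itself. -/
noncomputable def signedConjSimple (i : B) : Equiv.Perm (W × ZMod 2) :=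
  Function.Involutive.toPerm
    (fun p => (cs.simple i * p.1 * cs.simple i, p.2 + if p.1 = cs.simple i then 1 else 0)) <| by
  rintro ⟨t, ε⟩
  have h : cs.simple i * t * cs.simple i = cs.simple i ↔ t = cs.simple i := by
    constructor
    · intro h
      have := congrArg (fun z => cs.simple i * z * cs.simple i) h
      simpa [mul_assoc] using this
    · rintro rfl
      simp
  ext
  · simp [mul_assoc]
  · simp only [h, add_assoc]
    split_ifs
    · simp [show (1 : ZMod 2) + 1 = 0 from by decide]
    · simp

open Classical in
theorem signedConjSimple_apply (i : B) (t : W) (ε : ZMod 2) :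
    cs.signedConjSimple i (t, ε) =
      (cs.simple i * t * cs.simple i, ε + if t = cs.simple i then 1 else 0) :=
  rfl

open Classical in
theorem prod_map_signedConjSimple_apply (ω : List B) (t : W) (ε : ZMod 2) :
    (ω.map cs.signedConjSimple).prod (t, ε) =
      (cs.wordProd ω * t * (cs.wordProd ω)⁻¹, ε + (cs.rightInvSeq ω).count t) := by
  induction ω with
  | nil => simp
  | cons i ω ih =>
    have h : cs.wordProd ω * t * (cs.wordProd ω)⁻¹ = cs.simple i ↔
        (cs.wordProd ω)⁻¹ * cs.simple i * cs.wordProd ω = t := by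
      constructor
      · intro h
        rw [← h]
        group
      · rintro rfl
        group
    rw [List.map_cons, List.prod_cons, Equiv.Perm.mul_apply, ih, signedConjSimple_apply]
    simp only [h]
    simp only [rightInvSeq, List.count_cons, wordProd_cons, mul_inv_rev, inv_simple, beq_iff_eq,
      mul_assoc, Nat.cast_add, Nat.cast_ite, Nat.cast_one, Nat.cast_zero, add_assoc]

theorem prod_map_reverse_alternatingWord {G : Type*} [Monoid G] (f : B → G) (i i' : B) (m : ℕ) :
    ((alternatingWord i' i (2 * m)).reverse.map f).prod = (f i * f i') ^ m := by
  induction m with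
  | zero => simp [alternatingWord]
  | succ m ih =>
    rw [show 2 * (m + 1) = 2 * m + 1 + 1 from rfl, alternatingWord_succ', alternatingWord_succ']
    simp [ih, pow_succ, -List.map_reverse]

theorem leftInvSeq_alternatingWord_eq_append (i i' : B) :
    ∃ L, cs.leftInvSeq (alternatingWord i i' (2 * M i i')) = L ++ L := by
  set g : ℕ → W := fun k => cs.simple i * (cs.simple i' * cs.simple i) ^ k with hg
  have hL : cs.leftInvSeq (alternatingWord i i' (2 * M i i')) =
      (List.range (M i i' + M i i')).map g := by
    apply List.ext_getElem
    · simp [two_mul]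
    · intro k h₁ h₂
      have hk : k < 2 * M i i' := by simpa using h₁
      rw [cs.getElem_leftInvSeq_alternatingWord i i' _ k hk, prod_alternatingWord_eq_mul_pow,
        show (2 * k + 1) / 2 = k by lia]
      simp [hg]
  refine ⟨(List.range (M i i')).map g, ?_⟩
  rw [hL, List.range_add, List.map_append, List.map_map]
  congr 1
  refine List.map_congr_left fun k _ => ?_
  simp [hg, pow_add, M.symmetric i i']

theorem isLiftable_signedConjSimple : M.IsLiftable cs.signedConjSimple := by
  classical
  intro i i'
  rw [← prod_map_reverse_alternatingWord]
  refine Equiv.ext fun ⟨t, ε⟩ => ?_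
  obtain ⟨L, hL⟩ := cs.leftInvSeq_alternatingWord_eq_append i' i
  rw [M.symmetric i' i] at hL
  have hπ : cs.wordProd (alternatingWord i' i (2 * M i i')) = 1 := by
    rw [prod_alternatingWord_eq_mul_pow, Nat.mul_div_cancel_left _ two_pos, M.symmetric i i']
    simp
  rw [prod_map_signedConjSimple_apply, rightInvSeq_reverse, wordProd_reverse, hπ, hL]
  simp [CharTwo.add_self_eq_zero]

/-- The signed conjugation action of `W` on `W × ZMod 2`. -/
noncomputable def signedConj : W →* Equiv.Perm (W × ZMod 2) :=
  cs.lift ⟨cs.signedConjSimple, cs.isLiftable_signedConjSimple⟩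

/-- The number, modulo 2, of occurrences of `t` in the right inversion sequence of a word
for `w`. -/
noncomputable def invParity (w t : W) : ZMod 2 := (cs.signedConj w (t, 0)).2

theorem signedConj_wordProd (ω : List B) :
    cs.signedConj (cs.wordProd ω) = (ω.map cs.signedConjSimple).prod := by
  simp [wordProd, map_list_prod, signedConj, List.map_map, Function.comp_def, lift_apply_simple]

open Classical in
theorem invParity_wordProd (ω : List B) (t : W) :
    cs.invParity (cs.wordProd ω) t = (cs.rightInvSeq ω).count t := by
  simp [invParity, signedConj_wordProd, prod_map_signedConjSimple_apply]

theorem signedConj_apply (w t : W) (ε : ZMod 2) :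
    cs.signedConj w (t, ε) = (w * t * w⁻¹, ε + cs.invParity w t) := by
  obtain ⟨ω, rfl⟩ := cs.wordProd_surjective w
  rw [invParity_wordProd, signedConj_wordProd, prod_map_signedConjSimple_apply]

theorem invParity_mul (v w t : W) :
    cs.invParity (v * w) t = cs.invParity w t + cs.invParity v (w * t * w⁻¹) := by
  rw [invParity, map_mul, Equiv.Perm.mul_apply, signedConj_apply, signedConj_apply, zero_add]

open Classical in
theorem invParity_simple (i : B) (t : W) :
    cs.invParity (cs.simple i) t = if t = cs.simple i then 1 else 0 := by
  rw [← wordProd_singleton, invParity_wordProd]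
  simp [List.count_singleton, eq_comm (a := t)]

variable {cs} in
theorem IsReflection.invParity_self {t : W} (ht : cs.IsReflection t) : cs.invParity t t = 1 := by
  obtain ⟨v, i, rfl⟩ := ht
  have h1 : cs.invParity (v * v⁻¹) (v * cs.simple i * v⁻¹) = 0 := by
    rw [mul_inv_cancel, ← cs.wordProd_nil, invParity_wordProd]
    simp
  rw [invParity_mul] at h1
  rw [invParity_mul, invParity_mul, invParity_simple]
  have h2 : v⁻¹ * (v * cs.simple i * v⁻¹) * v⁻¹⁻¹ = cs.simple i := by group
  rw [h2] at h1 ⊢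
  rw [if_pos rfl, mul_inv_cancel_right, ← add_assoc, add_right_comm, h1, zero_add]

theorem length_mul_lt_of_invParity_eq_one {w t : W} (h : cs.invParity w t = 1) :
    cs.length (w * t) < cs.length w := by
  classical
  obtain ⟨ω, hω, rfl⟩ := cs.exists_isReduced w
  rw [invParity_wordProd] at h
  have hmem : t ∈ cs.rightInvSeq ω := by
    by_contra hmem
    simp [List.count_eq_zero_of_not_mem hmem] at h
  exact (cs.isRightInversion_of_mem_rightInvSeq hω hmem).2

variable {cs} in
/-- The strong exchange property, in terms of the parity of the inversion sequence. -/
theorem IsReflection.length_mul_lt_iff {w t : W} (ht : cs.IsReflection t) :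
    cs.length (w * t) < cs.length w ↔ cs.invParity w t = 1 := by
  refine ⟨fun h => ?_, cs.length_mul_lt_of_invParity_eq_one⟩
  by_contra hne
  have h0 : cs.invParity w t = 0 := by
    generalize cs.invParity w t = a at hne
    revert a
    decide
  have h1 : cs.invParity (w * t) t = 1 := by
    rw [invParity_mul, ht.invParity_self, mul_inv_cancel_right, h0, add_zero]
  have := cs.length_mul_lt_of_invParity_eq_one h1
  rw [mul_assoc, ht.mul_self, mul_one] at this
  exact h.not_gt this

variable {cs} in
theorem IsReflection.lt_length_mul_iff {w t : W} (ht : cs.IsReflection t) :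
    cs.length w < cs.length (w * t) ↔ ¬ cs.invParity w t = 1 := by
  rw [← ht.length_mul_lt_iff, not_lt, le_iff_lt_or_eq, or_iff_left (ht.length_mul_left_ne w).symm]

theorem length_simple_mul_lt {u t : W} (i : B) (ht : cs.IsReflection t)
    (h : cs.length u < cs.length (u * t)) (hne : u * t ≠ cs.simple i * u) :
    cs.length (cs.simple i * u) < cs.length (cs.simple i * (u * t)) := by
  rw [ht.lt_length_mul_iff] at h
  rw [← mul_assoc, ht.lt_length_mul_iff, invParity_mul, invParity_simple, if_neg, add_zero]
  · exact h
  · intro h'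
    exact hne (by rw [← h']; group)

theorem bruhatLE_trans {u v w : W} (h : cs.bruhatLE u v) (h' : cs.bruhatLE v w) :
    cs.bruhatLE u w :=
  Relation.ReflTransGen.trans h h'

variable {cs} in
theorem IsReflection.bruhatLE_mul {t : W} (ht : cs.IsReflection t) {u : W}
    (h : cs.length u < cs.length (u * t)) : cs.bruhatLE u (u * t) :=
  Relation.ReflTransGen.single ⟨t, ht, rfl, h⟩

theorem bruhatLE_simple_mul {w : W} {i : B} (h : cs.length w < cs.length (cs.simple i * w)) :
    cs.bruhatLE w (cs.simple i * w) := by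
  have ht := (cs.isReflection_simple i).conj w⁻¹
  have he : w * (w⁻¹ * cs.simple i * w⁻¹⁻¹) = cs.simple i * w := by group
  rw [← he] at h ⊢
  exact ht.bruhatLE_mul h

/-- The longer of `w` and `s i * w`. -/
noncomputable def simpleMax (i : B) (w : W) : W :=
  if cs.length w < cs.length (cs.simple i * w) then cs.simple i * w else w

/-- The shorter of `w` and `s i * w`. -/
noncomputable def simpleMin (i : B) (w : W) : W :=
  if cs.length w < cs.length (cs.simple i * w) then w else cs.simple i * w

theorem bruhatLE_simpleMax (i : B) (w : W) : cs.bruhatLE w (cs.simpleMax i w) := by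
  rw [simpleMax]
  split_ifs with h
  · exact cs.bruhatLE_simple_mul h
  · exact .refl

theorem simpleMin_bruhatLE (i : B) (w : W) : cs.bruhatLE (cs.simpleMin i w) w := by
  rw [simpleMin]
  split_ifs with h
  · exact .refl
  · have := cs.bruhatLE_simple_mul (w := cs.simple i * w) (i := i)
    rw [simple_mul_simple_cancel_left] at this
    exact this ((not_lt.mp h).lt_of_ne (cs.length_simple_mul_ne w i))

theorem simpleMax_simple_mul (i : B) (w : W) :
    cs.simpleMax i (cs.simple i * w) = cs.simpleMax i w := by
  have := cs.length_simple_mul_ne w i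
  rw [simpleMax, simpleMax, simple_mul_simple_cancel_left]
  split_ifs <;> first | rfl | lia

theorem simpleMin_simple_mul (i : B) (w : W) :
    cs.simpleMin i (cs.simple i * w) = cs.simpleMin i w := by
  have := cs.length_simple_mul_ne w i
  rw [simpleMin, simpleMin, simple_mul_simple_cancel_left]
  split_ifs <;> first | rfl | lia

theorem simple_mul_bruhatLE_simpleMax (i : B) (w : W) :
    cs.bruhatLE (cs.simple i * w) (cs.simpleMax i w) := by
  rw [← simpleMax_simple_mul]
  exact cs.bruhatLE_simpleMax i _

theorem simpleMin_bruhatLE_simple_mul (i : B) (w : W) :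
    cs.bruhatLE (cs.simpleMin i w) (cs.simple i * w) := by
  rw [← simpleMin_simple_mul]
  exact cs.simpleMin_bruhatLE i _

theorem simpleMax_mono (i : B) {u v : W} (h : cs.bruhatLE u v) :
    cs.bruhatLE (cs.simpleMax i u) (cs.simpleMax i v) := by
  induction h with
  | refl => exact .refl
  | @tail v w _ hvw ih =>
    refine cs.bruhatLE_trans ih ?_
    obtain ⟨t, ht, rfl, hlt⟩ := hvw
    by_cases hne : v * t = cs.simple i * v
    · rw [hne, simpleMax_simple_mul]
      exact .refl
    · have hlt' := cs.length_simple_mul_lt i ht hlt hne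
      rw [← mul_assoc] at hlt'
      rw [simpleMax]
      split_ifs
      · refine cs.bruhatLE_trans (ht.bruhatLE_mul hlt') ?_
        rw [mul_assoc]
        exact cs.simple_mul_bruhatLE_simpleMax i _
      · exact cs.bruhatLE_trans (ht.bruhatLE_mul hlt) (cs.bruhatLE_simpleMax i _)

theorem simpleMin_mono (i : B) {u v : W} (h : cs.bruhatLE u v) :
    cs.bruhatLE (cs.simpleMin i u) (cs.simpleMin i v) := by
  induction h with
  | refl => exact .refl
  | @tail v w _ hvw ih =>
    refine cs.bruhatLE_trans ih ?_
    obtain ⟨t, ht, rfl, hlt⟩ := hvw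
    by_cases hne : v * t = cs.simple i * v
    · rw [hne, simpleMin_simple_mul]
      exact .refl
    · have hlt' := cs.length_simple_mul_lt i ht hlt hne
      rw [← mul_assoc] at hlt'
      rw [simpleMin.eq_def cs i (v * t)]
      split_ifs
      · exact cs.bruhatLE_trans (cs.simpleMin_bruhatLE i v) (ht.bruhatLE_mul hlt)
      · rw [← mul_assoc]
        exact cs.bruhatLE_trans (cs.simpleMin_bruhatLE_simple_mul i v) (ht.bruhatLE_mul hlt')

/-- If `u * v` is a reduced product, `s i * u` is longer than `u` and `s i * (u * v)` is shorter
than `u * v`, then `s i` can be exchanged for a reflection shortening `v`. -/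
theorem exists_mul_eq_of_isLeftDescent_mul {u v : W} {i : B}
    (hu : cs.length u < cs.length (cs.simple i * u))
    (huv : cs.length (cs.simple i * (u * v)) < cs.length (u * v)) :
    ∃ v', cs.bruhatLE v' v ∧ cs.length v' < cs.length v ∧ u * v = cs.simple i * u * v' := by
  set r' := u⁻¹ * cs.simple i * u with hr'
  set r := v⁻¹ * r' * v with hr
  have hrefl' : cs.IsReflection r' := by
    simpa using (cs.isReflection_simple i).conj u⁻¹
  have hrefl : cs.IsReflection r := by
    simpa using hrefl'.conj v⁻¹
  have h₁ : cs.simple i * (u * v) = u * v * r := by rw [hr, hr']; group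
  have h₂ : cs.simple i * u = u * r' := by rw [hr']; group
  have h₃ : v * r * v⁻¹ = r' := by rw [hr]; group
  rw [h₁, hrefl.length_mul_lt_iff, invParity_mul, h₃] at huv
  rw [h₂, hrefl'.lt_length_mul_iff] at hu
  have hv : cs.length (v * r) < cs.length v := by
    rw [hrefl.length_mul_lt_iff]
    generalize cs.invParity v r = a at *
    generalize cs.invParity u r' = b at *
    revert a b
    decide
  refine ⟨v * r, ?_, hv, ?_⟩
  · have := hrefl.bruhatLE_mul (u := v * r)
    rw [mul_assoc, hrefl.mul_self, mul_one] at this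
    exact this hv
  · rw [h₂, hr]
    have := hrefl'.mul_self
    simp only [mul_assoc] at this ⊢
    rw [mul_inv_cancel_left, ← mul_assoc r' r', this, one_mul]

theorem eq_one_of_bruhatLE_one {u : W} (h : cs.bruhatLE u 1) : u = 1 := by
  obtain rfl | ⟨v, -, t, -, h1, hlt⟩ := Relation.ReflTransGen.cases_tail h
  · rfl
  · simp at hlt

/-- The Demazure product of `x` and `y`, with all the properties that characterize it. -/
theorem exists_isGreatest_mul (x y : W) :
    ∃ m x₁ y₁ : W, cs.bruhatLE x₁ x ∧ cs.bruhatLE y₁ y ∧ m = x₁ * y ∧ m = x * y₁ ∧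
      cs.length m = cs.length x₁ + cs.length y ∧ cs.length m = cs.length x + cs.length y₁ ∧
      (∀ u, cs.bruhatLE u x → cs.bruhatLE (u * y) m) ∧
      (∀ v, cs.bruhatLE v y → cs.bruhatLE (x * v) m) := by
  induction hn : cs.length x generalizing x with
  | zero =>
    obtain rfl := cs.length_eq_zero_iff.mp hn
    refine ⟨y, 1, y, .refl, .refl, by simp, by simp, by simp, by simp, fun u hu => ?_,
      fun v hv => by simpa using hv⟩
    rw [cs.eq_one_of_bruhatLE_one hu, one_mul]
    exact .refl
  | succ n ih =>
    obtain ⟨i, hi⟩ := cs.exists_leftDescent_of_ne_one (w := x) (by rintro rfl; simp at hn)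
    obtain ⟨x', rfl⟩ : ∃ x', x = cs.simple i * x' := ⟨cs.simple i * x, by simp⟩
    rw [isLeftDescent_iff, simple_mul_simple_cancel_left] at hi
    have hlt : cs.length x' < cs.length (cs.simple i * x') := by lia
    obtain ⟨m', x₁, y₁, hx₁, hy₁, hmx, hmy, hlx, hly, hl, hr⟩ := ih x' (by lia)
    have hmaxx : cs.simpleMax i x' = cs.simple i * x' := if_pos hlt
    have hminx : cs.simpleMin i (cs.simple i * x') = x' := by
      rw [simpleMin_simple_mul]
      exact if_pos hlt
    have hl' : ∀ u, cs.bruhatLE u (cs.simple i * x') →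
        cs.bruhatLE (u * y) (cs.simpleMax i m') := by
      intro u hu
      have hmin := cs.simpleMin_mono i hu
      rw [hminx] at hmin
      have hmax := cs.simpleMax_mono i (hl _ hmin)
      refine cs.bruhatLE_trans ?_ hmax
      rw [simpleMin]
      split_ifs
      · exact cs.bruhatLE_simpleMax i _
      · rw [mul_assoc, simpleMax_simple_mul]
        exact cs.bruhatLE_simpleMax i _
    have hr' : ∀ v, cs.bruhatLE v y →
        cs.bruhatLE (cs.simple i * x' * v) (cs.simpleMax i m') := by
      intro v hv
      rw [mul_assoc]
      exact cs.bruhatLE_trans (cs.simple_mul_bruhatLE_simpleMax i _) (cs.simpleMax_mono i (hr v hv))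
    by_cases hm : cs.length m' < cs.length (cs.simple i * m')
    · have hmaxm : cs.simpleMax i m' = cs.simple i * m' := if_pos hm
      rw [hmaxm] at hl' hr'
      have hlm : cs.length (cs.simple i * m') = cs.length m' + 1 := by
        have := cs.length_simple_mul m' i
        lia
      refine ⟨cs.simple i * m', cs.simple i * x₁, y₁, ?_, hy₁, by rw [hmx, mul_assoc],
        by rw [hmy, mul_assoc], ?_, by lia, hl', hr'⟩
      · rw [← hmaxx]
        exact cs.bruhatLE_trans (cs.simple_mul_bruhatLE_simpleMax i _) (cs.simpleMax_mono i hx₁)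
      · have h₁ := cs.length_mul_le (cs.simple i * x₁) y
        rw [mul_assoc, ← hmx] at h₁
        have h₂ := cs.length_simple_mul x₁ i
        lia
    · have hmaxm : cs.simpleMax i m' = m' := if_neg hm
      rw [hmaxm] at hl' hr'
      have hm' := (not_lt.mp hm).lt_of_ne (cs.length_simple_mul_ne m' i)
      rw [hmy] at hm'
      obtain ⟨y₂, hy₂, hly₂, he⟩ := cs.exists_mul_eq_of_isLeftDescent_mul hlt hm'
      rw [← hmy] at he
      refine ⟨m', x₁, y₂, cs.bruhatLE_trans hx₁ (cs.bruhatLE_simple_mul hlt),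
        cs.bruhatLE_trans hy₂ hy₁, hmx, he, hlx, ?_, hl', hr'⟩
      have := cs.length_mul_le (cs.simple i * x') y₂
      rw [← he] at this
      lia

end

end CoxeterSystem

/-- For all `x y` in a finite Coxeter group `W`, the set `{u * y : u ≤ x}` has a
unique maximal element `x ∗ y` in Bruhat order, which is also the unique maximal
element of `{x * v : v ≤ y}`; moreover `x ∗ y = x₁ * y = x * y₁` with `x₁ ≤ x`,
`y₁ ≤ y`, and `l(x ∗ y) = l(x₁) + l(y) = l(x) + l(y₁)`. -/
theorem demazure_product_exists {B W : Type*} [Group W] [Finite W] {M : CoxeterMatrix B}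
    (cs : CoxeterSystem M W) (x y : W) :
    ∃ m : W,
      m ∈ cs.lset x y ∧
      (∀ z ∈ cs.lset x y, cs.bruhatLE z m) ∧
      (∀ m' ∈ cs.lset x y, (∀ z ∈ cs.lset x y, cs.bruhatLE m' z → m' = z) → m' = m) ∧
      m ∈ cs.rset x y ∧
      (∀ z ∈ cs.rset x y, cs.bruhatLE z m) ∧
      (∀ m' ∈ cs.rset x y, (∀ z ∈ cs.rset x y, cs.bruhatLE m' z → m' = z) → m' = m) ∧
      (∃ x₁ y₁ : W, cs.bruhatLE x₁ x ∧ cs.bruhatLE y₁ y ∧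
        m = x₁ * y ∧ m = x * y₁ ∧
        cs.length m = cs.length x₁ + cs.length y ∧
        cs.length m = cs.length x + cs.length y₁) := by
  obtain ⟨m, x₁, y₁, hx₁, hy₁, hmx, hmy, hlx, hly, hl, hr⟩ := cs.exists_isGreatest_mul x y
  have hml : m ∈ cs.lset x y := ⟨x₁, hx₁, hmx⟩
  have hmr : m ∈ cs.rset x y := ⟨y₁, hy₁, hmy⟩
  have hl' : ∀ z ∈ cs.lset x y, cs.bruhatLE z m := by
    rintro z ⟨u, hu, rfl⟩
    exact hl u hu
  have hr' : ∀ z ∈ cs.rset x y, cs.bruhatLE z m := by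
    rintro z ⟨v, hv, rfl⟩
    exact hr v hv
  exact ⟨m, hml, hl', fun m' h h' => h' m hml (hl' m' h), hmr, hr',
    fun m' h h' => h' m hmr (hr' m' h), x₁, y₁, hx₁, hy₁, hmx, hmy, hlx, hly⟩
end

section
/- The map (x, y) ↦ x ◁ y is a right action of the monoid (W, ∗) on the set W: for all x, y, z ∈ W one has x ◁ e = x and x ◁ (y ∗ z) = (x ◁ y) ◁ z. -/
namespace CoxeterSystem

variable {B W : Type*} [Group W] {M : CoxeterMatrix B} (cs : CoxeterSystem M W)

/-! ### The reflection cocycle and the strong exchange property -/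

open Classical in
/-- The permutation `(t, ε) ↦ (s i * t * s i, ε + [t = s i])` of `W × ZMod 2`. -/
noncomputable def simpleSignedPerm (i : B) : Equiv.Perm (W × ZMod 2) :=
  Function.Involutive.toPerm
    (fun p => (cs.simple i * p.1 * cs.simple i, p.2 + if p.1 = cs.simple i then 1 else 0)) (by
      rintro ⟨t, ε⟩
      have h : cs.simple i * t * cs.simple i = cs.simple i ↔ t = cs.simple i := by
        rw [mul_assoc, mul_eq_left]
        constructor
        · intro h
          rw [eq_inv_of_mul_eq_one_left h, cs.inv_simple]
        · rintro rfl
          simp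
      ext
      · simp [mul_assoc]
      · simp only [h, add_assoc, CharTwo.add_self_eq_zero, add_zero])

open Classical in
theorem simpleSignedPerm_apply (i : B) (p : W × ZMod 2) :
    cs.simpleSignedPerm i p =
      (cs.simple i * p.1 * cs.simple i, p.2 + if p.1 = cs.simple i then 1 else 0) := rfl

open Classical in
theorem simpleSignedPerm_mul_pow_apply (i j : B) (k : ℕ) (t : W) (ε : ZMod 2) :
    ((cs.simpleSignedPerm i * cs.simpleSignedPerm j) ^ k) (t, ε) =
      ((cs.simple i * cs.simple j) ^ k * t * ((cs.simple i * cs.simple j) ^ k)⁻¹,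
        ε + ∑ n ∈ Finset.range (2 * k),
          if (cs.simple i * cs.simple j) ^ n * t = cs.simple j then 1 else 0) := by
  induction k with
  | zero => simp
  | succ k ih =>
    rw [pow_succ', Equiv.Perm.mul_apply, ih, Equiv.Perm.mul_apply, simpleSignedPerm_apply,
      simpleSignedPerm_apply]
    set r := cs.simple i * cs.simple j with hr
    have hj : cs.simple j * cs.simple j = 1 := cs.simple_mul_simple_self j
    have hi : cs.simple i * cs.simple i = 1 := cs.simple_mul_simple_self i
    have hrj : r * cs.simple j = cs.simple i := by rw [hr, mul_assoc, hj, mul_one]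
    have hjr : cs.simple j * r⁻¹ = cs.simple i := by
      rw [hr, mul_inv_rev, cs.inv_simple, cs.inv_simple, ← mul_assoc, hj, one_mul]
    have hconj : ∀ n : ℕ, cs.simple j * r ^ n = (r ^ n)⁻¹ * cs.simple j := by
      intro n
      have h : SemiconjBy (cs.simple j) r r⁻¹ := by
        change cs.simple j * r = r⁻¹ * cs.simple j
        simp [hr, mul_assoc]
      simpa using (h.pow_right n).eq
    have h1 : r ^ k * t * (r ^ k)⁻¹ = cs.simple j ↔ r ^ (2 * k) * t = cs.simple j := by
      rw [mul_inv_eq_iff_eq_mul, hconj, eq_inv_mul_iff_mul_eq, ← mul_assoc, ← pow_add, two_mul]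
    have h2 : cs.simple j * (r ^ k * t * (r ^ k)⁻¹) * cs.simple j = cs.simple i ↔
        r ^ (2 * k + 1) * t = cs.simple j := by
      have e : cs.simple i = cs.simple j * (r⁻¹ * cs.simple j) * cs.simple j := by
        rw [mul_assoc, mul_assoc, hj, mul_one, hjr]
      rw [e, mul_left_inj, mul_right_inj, mul_inv_eq_iff_eq_mul, mul_assoc, hconj,
        ← mul_assoc, ← mul_inv_rev, eq_inv_mul_iff_mul_eq, ← mul_assoc, ← pow_succ, ← pow_add]
      rw [show k + 1 + k = 2 * k + 1 by ring]
    simp only [h1, h2]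
    ext
    · simp [hr, pow_succ', mul_assoc]
    · rw [show 2 * (k + 1) = 2 * k + 1 + 1 by ring, Finset.sum_range_succ,
        Finset.sum_range_succ]
      simp only [add_assoc]

theorem isLiftable_simpleSignedPerm : M.IsLiftable cs.simpleSignedPerm := by
  classical
  intro i j
  ext1 ⟨t, ε⟩
  rw [simpleSignedPerm_mul_pow_apply, two_mul, Finset.sum_range_add]
  simp [pow_add, CharTwo.add_self_eq_zero]

/-- The action of `W` on `W × ZMod 2` extending `simpleSignedPerm`. -/
noncomputable def signedPerm : W →* Equiv.Perm (W × ZMod 2) :=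
  cs.lift ⟨cs.simpleSignedPerm, cs.isLiftable_simpleSignedPerm⟩

theorem signedPerm_simple (i : B) : cs.signedPerm (cs.simple i) = cs.simpleSignedPerm i :=
  cs.lift_apply_simple cs.isLiftable_simpleSignedPerm i

/-- The reflection cocycle: the parity of the number of occurrences of `t` in the right inversion
sequence of any word for `w`. -/
noncomputable def reflectionParity (w t : W) : ZMod 2 := (cs.signedPerm w (t, 0)).2

open Classical in
theorem reflectionParity_simple (i : B) (t : W) :
    cs.reflectionParity (cs.simple i) t = if t = cs.simple i then 1 else 0 := by
  rw [reflectionParity, signedPerm_simple, simpleSignedPerm_apply, zero_add]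

theorem signedPerm_apply (w t : W) (ε : ZMod 2) :
    cs.signedPerm w (t, ε) = (w * t * w⁻¹, ε + cs.reflectionParity w t) := by
  induction w using cs.simple_induction_left generalizing t ε with
  | one => simp [reflectionParity]
  | mul_simple_left w i ih =>
    have h : ∀ ε, cs.signedPerm (cs.simple i * w) (t, ε) =
        cs.simpleSignedPerm i (w * t * w⁻¹, ε + cs.reflectionParity w t) := by
      intro ε
      rw [map_mul, Equiv.Perm.mul_apply, ih, signedPerm_simple]
    rw [reflectionParity, h, h]
    ext <;> simp [simpleSignedPerm_apply, mul_assoc, add_assoc]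

@[simp]
theorem reflectionParity_one (t : W) : cs.reflectionParity 1 t = 0 := by
  simp [reflectionParity]

theorem reflectionParity_mul (u v t : W) :
    cs.reflectionParity (u * v) t =
      cs.reflectionParity v t + cs.reflectionParity u (v * t * v⁻¹) := by
  rw [reflectionParity, map_mul, Equiv.Perm.mul_apply, signedPerm_apply, signedPerm_apply,
    zero_add]

theorem reflectionParity_self {t : W} (ht : cs.IsReflection t) :
    cs.reflectionParity t t = 1 := by
  obtain ⟨u, i, rfl⟩ := ht
  have h := cs.reflectionParity_mul u u⁻¹ (u * cs.simple i * u⁻¹)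
  rw [mul_inv_cancel, reflectionParity_one] at h
  rw [reflectionParity_mul, reflectionParity_mul]
  have e : u⁻¹ * (u * cs.simple i * u⁻¹) * u⁻¹⁻¹ = cs.simple i := by group
  rw [e] at h ⊢
  rw [cs.inv_simple, cs.simple_mul_simple_self, one_mul, reflectionParity_simple, if_pos rfl,
    add_left_comm, ← h, add_zero]

theorem mem_rightInvSeq_of_reflectionParity_ne_zero (ω : List B) (t : W)
    (h : cs.reflectionParity (cs.wordProd ω) t ≠ 0) : t ∈ cs.rightInvSeq ω := by
  induction ω with
  | nil => simp at h
  | cons i ω ih =>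
    rw [rightInvSeq, List.mem_cons]
    by_contra! hn
    apply h
    rw [wordProd_cons, reflectionParity_mul, reflectionParity_simple, if_neg, add_zero]
    · by_contra h'
      exact hn.2 (ih h')
    · rw [mul_inv_eq_iff_eq_mul, ← eq_inv_mul_iff_mul_eq, ← mul_assoc]
      exact hn.1

theorem reflectionParity_eq_zero_iff {w t : W} (ht : cs.IsReflection t) :
    cs.reflectionParity w t = 0 ↔ cs.length w < cs.length (w * t) := by
  have key : ∀ w, cs.reflectionParity w t ≠ 0 → cs.length (w * t) < cs.length w := by
    intro w h
    obtain ⟨ω, hω, rfl⟩ := cs.exists_isReduced w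
    exact (cs.isRightInversion_of_mem_rightInvSeq hω
      (cs.mem_rightInvSeq_of_reflectionParity_ne_zero ω t h)).2
  constructor
  · intro h
    have h' := key (w * t) (by
      rw [reflectionParity_mul, cs.reflectionParity_self ht, mul_inv_cancel_right, h]
      decide)
    rwa [mul_assoc, ht.mul_self, mul_one] at h'
  · intro h
    by_contra h'
    exact lt_asymm h (key w h')

/-! ### The Bruhat order -/

variable {cs}

theorem bruhatLE.length_lt_or_eq {a b : W} (h : cs.bruhatLE a b) :
    a = b ∨ cs.length a < cs.length b := by
  induction h with
  | refl => exact Or.inl rfl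
  | tail _ hbc ih =>
    obtain ⟨_, _, _, hl⟩ := hbc
    rcases ih with rfl | ih
    · exact Or.inr hl
    · exact Or.inr (ih.trans hl)

theorem bruhatLE.antisymm {a b : W} (h : cs.bruhatLE a b) (h' : cs.bruhatLE b a) : a = b := by
  rcases h.length_lt_or_eq with e | e
  · exact e
  · rcases h'.length_lt_or_eq with e' | e'
    · exact e'.symm
    · exact absurd e' e.asymm

theorem bruhatLE.trans {a b c : W} (h : cs.bruhatLE a b) (h' : cs.bruhatLE b c) :
    cs.bruhatLE a c := Relation.ReflTransGen.trans h h'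

variable (cs)

theorem bruhatLE_refl (a : W) : cs.bruhatLE a a := Relation.ReflTransGen.refl

theorem bruhatLE_mul_reflection {a t : W} (ht : cs.IsReflection t)
    (h : cs.length a < cs.length (a * t)) : cs.bruhatLE a (a * t) :=
  Relation.ReflTransGen.single ⟨t, ht, rfl, h⟩

theorem bruhatLE_mul_simple {a : W} {i : B} (h : cs.length a < cs.length (a * cs.simple i)) :
    cs.bruhatLE a (a * cs.simple i) :=
  cs.bruhatLE_mul_reflection (cs.isReflection_simple i) h

theorem bruhatLE_one_iff {a : W} : cs.bruhatLE a 1 ↔ a = 1 := by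
  constructor
  · intro h
    simpa using h.length_lt_or_eq
  · rintro rfl
    exact cs.bruhatLE_refl 1

theorem mul_reflection_mul_simple_le {a t : W} (i : B) (ht : cs.IsReflection t)
    (h : cs.length a < cs.length (a * t)) :
    t = cs.simple i ∨ cs.bruhatLE (a * cs.simple i) (a * t * cs.simple i) := by
  by_cases hti : t = cs.simple i
  · exact Or.inl hti
  right
  have e : a * t * cs.simple i = a * cs.simple i * (cs.simple i * t * (cs.simple i)⁻¹) := by
    simp [mul_assoc]
  rw [e]
  refine cs.bruhatLE_mul_reflection (ht.conj _) ?_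
  rw [← cs.reflectionParity_eq_zero_iff (ht.conj _), reflectionParity_mul,
    reflectionParity_simple, if_neg, zero_add]
  · rw [← cs.reflectionParity_eq_zero_iff ht] at h
    rw [← h]
    congr 1
    simp [mul_assoc]
  · rw [mul_inv_eq_iff_eq_mul, mul_right_inj]
    exact hti

theorem simple_mul_reflection_le {a t : W} (i : B) (ht : cs.IsReflection t)
    (h : cs.length a < cs.length (a * t)) :
    cs.simple i * a = a * t ∨ cs.bruhatLE (cs.simple i * a) (cs.simple i * (a * t)) := by
  by_cases hti : a * t * a⁻¹ = cs.simple i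
  · exact Or.inl (mul_inv_eq_iff_eq_mul.mp hti).symm
  right
  rw [← mul_assoc]
  refine cs.bruhatLE_mul_reflection ht ?_
  rw [← cs.reflectionParity_eq_zero_iff ht, reflectionParity_mul, reflectionParity_simple,
    if_neg hti, add_zero]
  exact (cs.reflectionParity_eq_zero_iff ht).mpr h

variable {cs}

theorem bruhatLE.exists_simple_mul_le {a b : W} (h : cs.bruhatLE a b) (i : B) {e : W}
    (he : e = 1 ∨ e = cs.simple i) :
    ∃ e', (e' = 1 ∨ e' = cs.simple i) ∧ cs.bruhatLE (e * a) (e' * b) := by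
  induction h with
  | refl => exact ⟨e, he, cs.bruhatLE_refl _⟩
  | @tail b c _ hbc ih =>
    obtain ⟨e', he', hle⟩ := ih
    obtain ⟨t, ht, rfl, hl⟩ := hbc
    rcases he' with rfl | rfl
    · refine ⟨1, Or.inl rfl, hle.trans ?_⟩
      simpa using cs.bruhatLE_mul_reflection ht hl
    · rcases cs.simple_mul_reflection_le i ht hl with h | h
      · exact ⟨1, Or.inl rfl, by rwa [one_mul, ← h]⟩
      · exact ⟨_, Or.inr rfl, hle.trans h⟩

theorem bruhatLE.exists_mul_simple_le {a b : W} (h : cs.bruhatLE a b) (i : B) {e : W}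
    (he : e = 1 ∨ e = cs.simple i) :
    ∃ e', (e' = 1 ∨ e' = cs.simple i) ∧ cs.bruhatLE (a * e) (b * e') := by
  induction h with
  | refl => exact ⟨e, he, cs.bruhatLE_refl _⟩
  | @tail b c _ hbc ih =>
    obtain ⟨e', he', hle⟩ := ih
    obtain ⟨t, ht, rfl, hl⟩ := hbc
    rcases he' with rfl | rfl
    · refine ⟨1, Or.inl rfl, hle.trans ?_⟩
      simpa using cs.bruhatLE_mul_reflection ht hl
    · rcases cs.mul_reflection_mul_simple_le i ht hl with rfl | h
      · exact ⟨1, Or.inl rfl, by rwa [mul_one]⟩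
      · exact ⟨_, Or.inr rfl, hle.trans h⟩

theorem bruhatLE.exists_le_mul_simple {a b : W} (h : cs.bruhatLE a b) (i : B) {e : W}
    (he : e = 1 ∨ e = cs.simple i) :
    ∃ e', (e' = 1 ∨ e' = cs.simple i) ∧ cs.bruhatLE (a * e') (b * e) := by
  induction h generalizing e with
  | refl => exact ⟨e, he, cs.bruhatLE_refl _⟩
  | @tail b c _ hbc ih =>
    obtain ⟨t, ht, rfl, hl⟩ := hbc
    have : ∃ e', (e' = 1 ∨ e' = cs.simple i) ∧ cs.bruhatLE (b * e') (b * t * e) := by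
      rcases he with rfl | rfl
      · exact ⟨1, Or.inl rfl, by simpa using cs.bruhatLE_mul_reflection ht hl⟩
      · rcases cs.mul_reflection_mul_simple_le i ht hl with rfl | h
        · exact ⟨1, Or.inl rfl, by simpa using cs.bruhatLE_refl b⟩
        · exact ⟨_, Or.inr rfl, h⟩
    obtain ⟨e', he', hle⟩ := this
    obtain ⟨e'', he'', hle'⟩ := ih he'
    exact ⟨e'', he'', hle'.trans hle⟩

variable (cs)

/-- If `w < w * s i`, the lower interval of `w * s i` is the product of that of `w`
with `{1, s i}`. -/
theorem bruhatLE_mul_simple_iff {w : W} {i : B} (h : cs.length w < cs.length (w * cs.simple i))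
    {u : W} : cs.bruhatLE u (w * cs.simple i) ↔
      ∃ v e, cs.bruhatLE v w ∧ (e = 1 ∨ e = cs.simple i) ∧ u = v * e := by
  constructor
  · intro hu
    obtain ⟨e, he, hle⟩ := hu.exists_le_mul_simple i (Or.inr rfl)
    rw [mul_assoc, cs.simple_mul_simple_self, mul_one] at hle
    refine ⟨u * e, e, hle, he, ?_⟩
    rcases he with rfl | rfl <;> simp
  · rintro ⟨v, e, hv, he, rfl⟩
    obtain ⟨e', rfl | rfl, hle⟩ := hv.exists_mul_simple_le i he
    · rw [mul_one] at hle
      exact hle.trans (cs.bruhatLE_mul_simple h)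
    · exact hle

/-- Induction along reduced words. -/
theorem length_induction_right {p : W → Prop} (w : W) (one : p 1)
    (mul_simple : ∀ w i, cs.length w < cs.length (w * cs.simple i) → p w →
      p (w * cs.simple i)) : p w := by
  induction hn : cs.length w using Nat.strong_induction_on generalizing w with
  | _ n ih =>
    by_cases hw : w = 1
    · rwa [hw]
    obtain ⟨i, hi⟩ := cs.exists_rightDescent_of_ne_one hw
    rw [IsRightDescent] at hi
    have h := mul_simple (w * cs.simple i) i (by simpa using hi) (ih _ (hn ▸ hi) _ rfl)
    simpa using h

variable {cs}

theorem bruhatLE.exists_le_mul {a b w z : W} (h : cs.bruhatLE a b) (hw : cs.bruhatLE w z) :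
    ∃ w', cs.bruhatLE w' z ∧ cs.bruhatLE (a * w') (b * w) := by
  induction z using cs.length_induction_right generalizing w with
  | one =>
    rw [bruhatLE_one_iff] at hw
    subst hw
    exact ⟨1, cs.bruhatLE_refl 1, by simpa using h⟩
  | mul_simple z i hz ih =>
    obtain ⟨v, e, hv, he, rfl⟩ := (cs.bruhatLE_mul_simple_iff hz).mp hw
    obtain ⟨w', hw', hle⟩ := ih hv
    obtain ⟨e', he', hle'⟩ := hle.exists_le_mul_simple i he
    exact ⟨w' * e', (cs.bruhatLE_mul_simple_iff hz).mpr ⟨w', e', hw', he', rfl⟩,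
      by simpa only [mul_assoc] using hle'⟩

theorem bruhatLE.exists_mul_le_mul {v y w z : W} (hv : cs.bruhatLE v y) (hw : cs.bruhatLE w z) :
    ∃ v', cs.bruhatLE v' y ∧ cs.bruhatLE (v * w) (v' * z) := by
  induction y using cs.length_induction_right generalizing v w z with
  | one =>
    rw [bruhatLE_one_iff] at hv
    subst hv
    exact ⟨1, cs.bruhatLE_refl 1, by simpa using hw⟩
  | mul_simple y i hy ih =>
    obtain ⟨u, e, hu, he, rfl⟩ := (cs.bruhatLE_mul_simple_iff hy).mp hv
    obtain ⟨e', he', hle⟩ := hw.exists_simple_mul_le i he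
    obtain ⟨v', hv', hle'⟩ := ih hu hle
    exact ⟨v' * e', (cs.bruhatLE_mul_simple_iff hy).mpr ⟨v', e', hv', he', rfl⟩,
      by simpa only [mul_assoc] using hle'⟩

/-- The product of two lower intervals is a lower set. -/
theorem bruhatLE.exists_eq_mul_of_le_mul {p v y w z : W} (hp : cs.bruhatLE p (v * w))
    (hv : cs.bruhatLE v y) (hw : cs.bruhatLE w z) :
    ∃ v' w', cs.bruhatLE v' y ∧ cs.bruhatLE w' z ∧ p = v' * w' := by
  induction z using cs.length_induction_right generalizing p w with
  | one =>
    rw [bruhatLE_one_iff] at hw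
    subst hw
    rw [mul_one] at hp
    exact ⟨p, 1, hp.trans hv, cs.bruhatLE_refl 1, (mul_one p).symm⟩
  | mul_simple z i hz ih =>
    obtain ⟨u, e, hu, he, rfl⟩ := (cs.bruhatLE_mul_simple_iff hz).mp hw
    obtain ⟨e', he', hle⟩ := hp.exists_le_mul_simple i he
    have hee : e * e = 1 := by rcases he with rfl | rfl <;> simp
    have hee' : e' * e' = 1 := by rcases he' with rfl | rfl <;> simp
    rw [mul_assoc, mul_assoc, hee, mul_one] at hle
    obtain ⟨v', w', hv', hw', h⟩ := ih hle hu
    refine ⟨v', w' * e', hv', (cs.bruhatLE_mul_simple_iff hz).mpr ⟨w', e', hw', he', rfl⟩, ?_⟩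
    rw [← mul_assoc, ← h, mul_assoc, hee', mul_one]

end CoxeterSystem

/-- The map `(x, y) ↦ x ◁ y` is a right action of the monoid `(W, ∗)` on `W`:
`x ◁ e = x` and `x ◁ (y ∗ z) = (x ◁ y) ◁ z`. -/
theorem ltr_right_monoid_action {B W : Type*} [Group W] [Finite W] {M : CoxeterMatrix B}
    (cs : CoxeterSystem M W) (star ltr : W → W → W)
    (hstar : ∀ x y : W, star x y ∈ cs.lset x y ∧
      ∀ z ∈ cs.lset x y, cs.bruhatLE z (star x y))
    (hltr : ∀ x y : W, ltr x y ∈ cs.rset x y ∧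
      ∀ z ∈ cs.rset x y, cs.bruhatLE (ltr x y) z) :
    (∀ x : W, ltr x 1 = x) ∧
    (∀ x y z : W, ltr x (star y z) = ltr (ltr x y) z) := by
  have mem_star : ∀ {y z p : W}, cs.bruhatLE p (star y z) ↔
      ∃ v w, cs.bruhatLE v y ∧ cs.bruhatLE w z ∧ p = v * w := by
    intro y z p
    constructor
    · intro hp
      obtain ⟨u, hu, he⟩ := (hstar y z).1
      rw [he] at hp
      exact hp.exists_eq_mul_of_le_mul hu (cs.bruhatLE_refl z)
    · rintro ⟨v, w, hv, hw, rfl⟩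
      obtain ⟨v', hv', hle⟩ := hv.exists_mul_le_mul hw
      exact hle.trans ((hstar y z).2 _ ⟨v', hv', rfl⟩)
  refine ⟨fun x => ?_, fun x y z => ?_⟩
  · obtain ⟨v, hv, he⟩ := (hltr x 1).1
    rw [he, cs.bruhatLE_one_iff.mp hv, mul_one]
  · apply CoxeterSystem.bruhatLE.antisymm (cs := cs)
    · obtain ⟨v, hv, he⟩ := (hltr x y).1
      obtain ⟨w, hw, he'⟩ := (hltr (ltr x y) z).1
      exact (hltr x (star y z)).2 _
        ⟨v * w, mem_star.mpr ⟨v, w, hv, hw, rfl⟩, by rw [he', he, mul_assoc]⟩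
    · obtain ⟨p, hp, he⟩ := (hltr x (star y z)).1
      obtain ⟨v, w, hv, hw, rfl⟩ := mem_star.mp hp
      obtain ⟨w', hw', hle⟩ := ((hltr x y).2 _ ⟨v, hv, rfl⟩).exists_le_mul hw
      rw [he, ← mul_assoc]
      exact ((hltr (ltr x y) z).2 _ ⟨w', hw', rfl⟩).trans hle
end
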